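/- Let p be an odd prime, k ≥ 2, and m ≥ 3 odd. Let χ1,…,χk be primitive characters mod p^m such that χ1⋯χk is also primitive mod p^m, and set v := c1+⋯+ck (so p ∤ v). Then J(χ1,…,χk,p^m) = p^{m(k−1)/2} · χ1(c1)⋯χk(ck) · (χ1⋯χk(v))^{−1} · (−2r/p)^{k−1} · (v·c1⋯ck/p) · ε_p^{k−1}. -/

import Mathlib

open Complex

/-- The generalized Jacobi sum `J_B(χ₁,…,χ_k, q)`; `J(χ₁,…,χ_k,q) = J_1`. -/
noncomputable def Jsum {q : ℕ} [NeZero q] {k : ℕ}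
    (χ : Fin k → DirichletCharacter ℂ q) (B : ZMod q) : ℂ :=
  ∑ x : Fin k → ZMod q, if (∑ i, x i) = B then ∏ i, χ i (x i) else 0

/-- `ε_q = 1` if `q ≡ 1 (mod 4)` and `i` if `q ≡ 3 (mod 4)`. -/
noncomputable def eps (q : ℕ) : ℂ := if q % 4 = 1 then 1 else Complex.I

section

open Polynomial Finset

theorem sum_eval_of_monic_natDegree_eq {K : Type*} [Field K] [Fintype K] {f : K[X]}
    (hf : f.Monic) (hd : f.natDegree = Fintype.card K - 1) : ∑ x : K, f.eval x = -1 := by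
  classical
  have hq : 1 < Fintype.card K := Fintype.one_lt_card
  simp_rw [eval_eq_sum_range]
  rw [Finset.sum_comm, Finset.sum_range_succ]
  rw [Finset.sum_eq_zero, zero_add, hf.coeff_natDegree]
  · simp_rw [one_mul, hd]
    rw [← Finset.sum_erase_add _ _ (Finset.mem_univ (0 : K)), zero_pow (by omega), add_zero,
      Finset.sum_congr rfl (g := fun _ => (1 : K))]
    · rw [Finset.sum_const, Finset.card_erase_of_mem (Finset.mem_univ _), Finset.card_univ,
        nsmul_eq_mul, mul_one, Nat.cast_sub hq.le, Nat.cast_card_eq_zero]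
      simp
    · intro x hx
      exact FiniteField.pow_card_sub_one_eq_one x (Finset.ne_of_mem_erase hx)
  · intro i hi
    rw [← Finset.mul_sum, FiniteField.sum_pow_lt_card_sub_one K i, mul_zero]
    rw [← hd]; exact Finset.mem_range.1 hi

variable {p : ℕ} [Fact p.Prime] {h : ℕ}

theorem factorial_mul_coeff_taylor_quadraticChar (hph : p = 2 * h + 1) (hh : 0 < h) :
    (h.factorial : ZMod p) * (taylor 1 (∑ x : ZMod p,
      C ((quadraticChar (ZMod p) x : ℤ) : ZMod p) * X ^ x.val)).coeff h = -1 := by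
  have key : ∀ x : ZMod p, (h.factorial : ZMod p) * (taylor 1
      (C ((quadraticChar (ZMod p) x : ℤ) : ZMod p) * X ^ x.val)).coeff h =
      (X ^ h * descPochhammer (ZMod p) h).eval x := by
    intro x
    rw [taylor_mul, taylor_C, coeff_C_mul, taylor_pow, taylor_X, map_one,
      coeff_X_add_one_pow,
      quadraticChar_eq_pow_of_char_ne_two' (by rw [ZMod.ringChar_zmod_n]; omega), ZMod.card,
      show p / 2 = h by omega, eval_mul, eval_pow, eval_X]
    have : ((h.factorial * x.val.choose h : ℕ) : ZMod p) = (descPochhammer (ZMod p) h).eval x := by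
      rw [← Nat.descFactorial_eq_factorial_mul_choose, ← descPochhammer_eval_eq_descFactorial,
        ZMod.natCast_zmod_val]
    rw [← this]
    push_cast
    ring
  rw [map_sum, finsetSum_coeff, Finset.mul_sum, Finset.sum_congr rfl fun x _ => key x]
  apply sum_eval_of_monic_natDegree_eq
  · exact (monic_X_pow h).mul (monic_descPochhammer _ h)
  · rw [(monic_X_pow h).natDegree_mul (monic_descPochhammer _ h), natDegree_X_pow,
      descPochhammer_natDegree, ZMod.card]
    omega

theorem factorial_mul_coeff_taylor_prod (hph : p = 2 * h + 1) :
    (h.factorial : ZMod p) * (taylor 1 (∏ k ∈ range h,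
      (X ^ (2 * k + 1) - X ^ (p - (2 * k + 1)) : (ZMod p)[X]))).coeff h = -1 := by
  have key : ∀ k ∈ range h, ∃ g : (ZMod p)[X],
      taylor 1 (X ^ (2 * k + 1) - X ^ (p - (2 * k + 1)) : (ZMod p)[X]) = X * g ∧
      g.coeff 0 = 2 * ((2 * k + 1 : ℕ) : ZMod p) := by
    intro k hk
    rw [mem_range] at hk
    obtain ⟨g, hg⟩ : X ∣ taylor 1 (X ^ (2 * k + 1) - X ^ (p - (2 * k + 1)) : (ZMod p)[X]) := by
      rw [X_dvd_iff, taylor_coeff_zero]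
      simp
    refine ⟨g, hg, ?_⟩
    have := taylor_coeff_one (1 : ZMod p) (X ^ (2 * k + 1) - X ^ (p - (2 * k + 1)))
    rw [hg, coeff_X_mul] at this
    rw [this]
    simp [derivative_X_pow, Nat.cast_sub (show 2 * k + 1 ≤ p by omega)]
    ring
  choose! g hg hg0 using key
  have : taylor 1 (∏ k ∈ range h, (X ^ (2 * k + 1) - X ^ (p - (2 * k + 1)) : (ZMod p)[X])) =
      X ^ h * ∏ k ∈ range h, g k := by
    rw [← taylorAlgHom_apply, map_prod]
    simp only [taylorAlgHom_apply]
    rw [Finset.prod_congr rfl hg, Finset.prod_mul_distrib, Finset.prod_const, card_range]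
  rw [this, coeff_X_pow_mul', if_pos le_rfl, Nat.sub_self, coeff_zero_prod,
    Finset.prod_congr rfl hg0]
  have hfac : ∀ n : ℕ, n.factorial * ∏ k ∈ range n, (2 * (2 * k + 1)) = (2 * n).factorial := by
    intro n
    induction n with
    | zero => simp
    | succ n ih =>
      rw [Finset.prod_range_succ, Nat.factorial_succ, show 2 * (n + 1) = 2 * n + 1 + 1 by ring,
        Nat.factorial_succ, Nat.factorial_succ, ← ih]
      ring
  have := congrArg (Nat.cast : ℕ → ZMod p) (hfac h)
  rw [show 2 * h = p - 1 by omega, ZMod.wilsons_lemma] at this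
  rw [← this]
  push_cast
  ring

theorem quadraticChar_poly_sign (hph : p = 2 * h + 1) (hh : 0 < h) {ζ : ℂ} (hζ : IsPrimitiveRoot ζ p)
    (hsq : (∑ x : ZMod p, (quadraticChar (ZMod p) x : ℂ) * ζ ^ x.val) ^ 2 =
      (∏ k ∈ range h, (ζ ^ (2 * k + 1) - ζ ^ (p - (2 * k + 1)))) ^ 2) :
    (∑ x : ZMod p, (quadraticChar (ZMod p) x : ℂ) * ζ ^ x.val) =
      ∏ k ∈ range h, (ζ ^ (2 * k + 1) - ζ ^ (p - (2 * k + 1))) := by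
  rcases sq_eq_sq_iff_eq_or_eq_neg.1 hsq with h1 | h1
  · exact h1
  exfalso
  set A : ℤ[X] := ∑ x : ZMod p, C (quadraticChar (ZMod p) x) * X ^ x.val with hA
  set B : ℤ[X] := ∏ k ∈ range h, (X ^ (2 * k + 1) - X ^ (p - (2 * k + 1))) with hB
  have hz : aeval ζ (A + B) = 0 := by
    rw [map_add, hA, hB, map_sum, map_prod]
    simp [-quadraticChar_apply, h1]
  have hdvd : cyclotomic p ℤ ∣ A + B := by
    rw [cyclotomic_eq_minpoly hζ (by omega)]
    exact minpoly.isIntegrallyClosed_dvd (hζ.isIntegral (by omega)) hz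
  obtain ⟨D, hD⟩ := hdvd
  have h2 := congrArg (fun f => taylor (1 : ZMod p) (f.map (Int.castRingHom (ZMod p)))) hD
  simp only [Polynomial.map_add, Polynomial.map_mul, map_cyclotomic, map_add, taylor_mul] at h2
  have hc : cyclotomic p (ZMod p) = (X - 1) ^ (p - 1) := by
    have := cyclotomic_mul_prime_pow_eq (ZMod p) (p := p) (m := 1)
      (by simpa using (Fact.out : p.Prime).one_lt.ne') (k := 1) one_pos
    simpa using this
  rw [hc, taylor_pow] at h2
  have h3 : taylor (1 : ZMod p) (X - 1) = X := by simp
  rw [h3] at h2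
  have h4 := congrArg (fun f => (h.factorial : ZMod p) * f.coeff h) h2
  have hA' : A.map (Int.castRingHom (ZMod p)) =
      ∑ x : ZMod p, C ((quadraticChar (ZMod p) x : ℤ) : ZMod p) * X ^ x.val := by
    rw [hA, Polynomial.map_sum]; simp
  have hB' : B.map (Int.castRingHom (ZMod p)) =
      ∏ k ∈ range h, (X ^ (2 * k + 1) - X ^ (p - (2 * k + 1))) := by
    rw [hB, Polynomial.map_prod]; simp
  simp only [coeff_add, mul_add] at h4
  rw [hA', hB', factorial_mul_coeff_taylor_quadraticChar hph hh,
    factorial_mul_coeff_taylor_prod hph, coeff_X_pow_mul', if_neg (by omega), mul_zero] at h4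
  have h5 : (2 : ZMod p) = 0 := by linear_combination -h4
  exact (Ring.two_ne_zero (R := ZMod p) (by rw [ZMod.ringChar_zmod_n]; omega)) h5

theorem prod_sub_pow_sq {p h : ℕ} (hph : p = 2 * h + 1) {ζ : ℂ} (hζ : IsPrimitiveRoot ζ p) :
    (∏ k ∈ range h, (ζ ^ (2 * k + 1) - ζ ^ (p - (2 * k + 1)))) ^ 2 = (-1) ^ h * p := by
  have hη : IsPrimitiveRoot (ζ ^ 2) (2 * h + 1) :=
    hph ▸ hζ.pow_of_coprime 2 (by rw [hph]; simp)
  have hprod := hη.prod_one_sub_pow_eq_order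
  have hsplit : ∀ (F : ℕ → ℂ) (n : ℕ), ∏ i ∈ range (2 * n), F i =
      ∏ k ∈ range n, (F (2 * k) * F (2 * k + 1)) := by
    intro F n
    induction n with
    | zero => simp
    | succ n ih =>
      rw [show 2 * (n + 1) = 2 * n + 1 + 1 by ring, prod_range_succ, prod_range_succ, ih,
        prod_range_succ, mul_assoc]
  rw [hsplit, prod_mul_distrib, ← prod_range_reflect (fun k => 1 - (ζ ^ 2) ^ (2 * k + 1 + 1)),
    ← prod_mul_distrib] at hprod
  have hterm : ∀ k ∈ range h, (1 - (ζ ^ 2) ^ (2 * k + 1)) *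
      (1 - (ζ ^ 2) ^ (2 * (h - 1 - k) + 1 + 1)) =
      -1 * (ζ ^ (2 * k + 1) - ζ ^ (p - (2 * k + 1))) ^ 2 := by
    intro k hk
    rw [mem_range] at hk
    have e1 : 2 * (2 * (h - 1 - k) + 1 + 1) = 2 * (p - (2 * k + 1)) := by omega
    have e2 : ζ ^ (2 * k + 1) * ζ ^ (p - (2 * k + 1)) = 1 := by
      rw [← pow_add, show 2 * k + 1 + (p - (2 * k + 1)) = p by omega, hζ.pow_eq_one]
    rw [← pow_mul, ← pow_mul, e1, mul_comm 2 (2 * k + 1), mul_comm 2 (p - _), pow_mul, pow_mul ζ]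
    generalize ζ ^ (p - (2 * k + 1)) = u at e2 ⊢
    generalize ζ ^ (2 * k + 1) = w at e2 ⊢
    linear_combination (u * w - 1) * e2
  rw [prod_congr rfl hterm, prod_mul_distrib, prod_const, card_range, prod_pow] at hprod
  have h1 : ((-1 : ℂ) ^ h) * (-1) ^ h = 1 := by rw [← mul_pow]; simp
  have h2 : (p : ℂ) = (2 * h : ℕ) + 1 := by rw [hph]; push_cast; ring
  rw [h2]
  generalize ∏ k ∈ range h, (ζ ^ (2 * k + 1) - ζ ^ (p - (2 * k + 1))) = u at hprod ⊢
  linear_combination (-1) ^ h * hprod - u ^ 2 * h1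

theorem exp_pow_sub_exp_pow {p s : ℕ} (hp : p ≠ 0) (hs : s ≤ p) :
    Complex.exp (2 * Real.pi * Complex.I / p) ^ s - Complex.exp (2 * Real.pi * Complex.I / p) ^ (p - s)
      = 2 * Complex.I * (Real.sin (2 * Real.pi * s / p) : ℝ) := by
  have hp' : (p : ℂ) ≠ 0 := by exact_mod_cast hp
  have h1 : Complex.exp (2 * Real.pi * Complex.I / p) ^ (p - s) =
      Complex.exp (-(2 * Real.pi * s / p * Complex.I)) := by
    rw [← Complex.exp_nat_mul, Nat.cast_sub hs, show ((p : ℂ) - s) * (2 * Real.pi * Complex.I / p) =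
      2 * Real.pi * Complex.I + -(2 * Real.pi * s / p * Complex.I) by field_simp; ring,
      Complex.exp_add, Complex.exp_two_pi_mul_I, one_mul]
  have h2 : Complex.exp (2 * Real.pi * Complex.I / p) ^ s =
      Complex.exp ((2 * Real.pi * s / p * Complex.I)) := by
    rw [← Complex.exp_nat_mul]
    congr 1
    ring
  rw [h1, h2]
  push_cast
  rw [Complex.sin, neg_mul]
  linear_combination (-Complex.exp (-(2 * Real.pi * s / p * Complex.I)) + Complex.exp ((2 * Real.pi * s / p * Complex.I))) * Complex.I_mul_I

theorem exists_pos_prod_sin {p h : ℕ} (hph : p = 2 * h + 1) :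
    ∃ R : ℝ, 0 < R ∧ ∏ k ∈ range h, (2 * Real.sin (2 * Real.pi * (2 * k + 1 : ℕ) / p)) =
      (-1) ^ (h / 2) * R := by
  have hp : (0 : ℝ) < p := by rw [hph]; positivity
  refine ⟨(∏ k ∈ range (h - h / 2), (2 * Real.sin (2 * Real.pi * (2 * k + 1 : ℕ) / p))) *
    ∏ k ∈ range (h / 2), -(2 * Real.sin (2 * Real.pi * (2 * (h - h / 2 + k) + 1 : ℕ) / p)),
    mul_pos (prod_pos ?_) (prod_pos ?_), ?_⟩
  · intro k hk
    rw [mem_range] at hk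
    refine mul_pos two_pos (Real.sin_pos_of_pos_of_lt_pi ?_ ?_)
    · have := Real.pi_pos
      positivity
    · rw [div_lt_iff₀ hp]
      have : ((2 * (2 * k + 1) : ℕ) : ℝ) < p := by
        rw [Nat.cast_lt]; omega
      push_cast at this ⊢
      nlinarith [Real.pi_pos]
  · intro k hk
    rw [mem_range] at hk
    have h1 : (p : ℝ) < ((2 * (2 * (h - h / 2 + k) + 1) : ℕ) : ℝ) := by
      rw [Nat.cast_lt]; omega
    have h2 : ((2 * (2 * (h - h / 2 + k) + 1) : ℕ) : ℝ) < 2 * p := by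
      norm_cast; omega
    have hpi := Real.pi_pos
    have : Real.sin (2 * Real.pi * (2 * (h - h / 2 + k) + 1 : ℕ) / p) < 0 := by
      rw [← Real.sin_sub_two_pi]
      apply Real.sin_neg_of_neg_of_neg_pi_lt
      · rw [sub_neg, div_lt_iff₀ hp]
        rw [Nat.cast_mul] at h2
        push_cast only [Nat.cast_ofNat] at h2
        nlinarith
      · rw [lt_sub_iff_add_lt, lt_div_iff₀ hp]
        rw [Nat.cast_mul] at h1
        push_cast only [Nat.cast_ofNat] at h1
        nlinarith
    linarith
  · have hs : h = (h - h / 2) + h / 2 := by omega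
    conv_lhs => rw [hs, prod_range_add]
    rw [prod_neg, card_range]
    have h1 : ((-1 : ℝ) ^ (h / 2)) * (-1) ^ (h / 2) = 1 := by rw [← mul_pow]; simp
    generalize ∏ k ∈ range (h - h / 2), (2 * Real.sin (2 * Real.pi * (2 * k + 1 : ℕ) / p)) = u
    generalize ∏ k ∈ range (h / 2), (2 * Real.sin (2 * Real.pi * (2 * (h - h / 2 + k) + 1 : ℕ) / p)) = w
    linear_combination -u * w * h1

theorem prod_exp_sub_exp_eq {p h : ℕ} (hph : p = 2 * h + 1) :
    ∏ k ∈ range h, (Complex.exp (2 * Real.pi * Complex.I / p) ^ (2 * k + 1) -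
      Complex.exp (2 * Real.pi * Complex.I / p) ^ (p - (2 * k + 1))) = eps p * Real.sqrt p := by
  have hp : p ≠ 0 := by omega
  have hsq := prod_sub_pow_sq hph (Complex.isPrimitiveRoot_exp p hp)
  obtain ⟨R, hR, hRe⟩ := exists_pos_prod_sin hph
  have hprod : ∏ k ∈ range h, (Complex.exp (2 * Real.pi * Complex.I / p) ^ (2 * k + 1) -
      Complex.exp (2 * Real.pi * Complex.I / p) ^ (p - (2 * k + 1))) = eps p * R := by
    have : ∀ k ∈ range h, (Complex.exp (2 * Real.pi * Complex.I / p) ^ (2 * k + 1) -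
      Complex.exp (2 * Real.pi * Complex.I / p) ^ (p - (2 * k + 1))) =
      Complex.I * ((2 * Real.sin (2 * Real.pi * (2 * k + 1 : ℕ) / p) : ℝ) : ℂ) := by
      intro k hk
      rw [mem_range] at hk
      rw [exp_pow_sub_exp_pow hp (by omega)]
      push_cast
      ring
    rw [prod_congr rfl this, prod_mul_distrib, prod_const, card_range, ← Complex.ofReal_prod, hRe]
    have hI : Complex.I ^ h * (-1) ^ (h / 2) = eps p := by
      unfold eps
      rcases Nat.even_or_odd' h with ⟨t, ht | ht⟩
      · rw [if_pos (by omega), ht, Nat.mul_div_cancel_left _ two_pos, pow_mul, Complex.I_sq,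
          ← mul_pow]
        simp
      · rw [if_neg (by omega), ht, show (2 * t + 1) / 2 = t by omega, pow_succ, pow_mul,
          Complex.I_sq]
        have h1 : ((-1 : ℂ) ^ t) * (-1) ^ t = 1 := by rw [← mul_pow]; simp
        linear_combination Complex.I * h1
    rw [← hI]
    push_cast
    ring
  rw [hprod]
  have heps : eps p ^ 2 = (-1) ^ h := by
    unfold eps
    split_ifs with h1
    · rw [Even.neg_one_pow (by rw [Nat.even_iff]; omega), one_pow]
    · rw [Odd.neg_one_pow (by rw [Nat.odd_iff]; omega), Complex.I_sq]
  rw [hprod, mul_pow, heps] at hsq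
  have h2 : ((R ^ 2 : ℝ) : ℂ) = (p : ℝ) := by
    push_cast
    exact mul_left_cancel₀ (pow_ne_zero _ (by norm_num)) hsq
  rw [← Complex.ofReal_inj.1 h2, Real.sqrt_sq hR.le]

theorem sum_quadraticChar_mul_stdAddChar {p : ℕ} [Fact p.Prime] (hp2 : p ≠ 2) :
    ∑ x : ZMod p, (quadraticChar (ZMod p) x : ℂ) * ZMod.stdAddChar x = eps p * Real.sqrt p := by
  have hp : p.Prime := Fact.out
  obtain ⟨h, hph⟩ : ∃ h, p = 2 * h + 1 := hp.odd_of_ne_two hp2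
  have hh : 0 < h := by have := hp.two_le; omega
  set ζ := Complex.exp (2 * Real.pi * Complex.I / p) with hζdef
  have hζ : IsPrimitiveRoot ζ p := Complex.isPrimitiveRoot_exp p hp.ne_zero
  have hval : ∀ x : ZMod p, ZMod.stdAddChar x = ζ ^ x.val := by
    intro x
    conv_lhs => rw [← ZMod.natCast_zmod_val x]
    have := ZMod.stdAddChar_coe (N := p) x.val
    rw [Int.cast_natCast] at this
    rw [this, hζdef, ← Complex.exp_nat_mul]
    congr 1
    push_cast
    ring
  have hchar : ringChar (ZMod p) ≠ 2 := by rwa [ZMod.ringChar_zmod_n]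
  simp_rw [hval]
  rw [quadraticChar_poly_sign hph hh hζ, hζdef, prod_exp_sub_exp_eq hph]
  rw [prod_sub_pow_sq hph hζ]
  have hsq := gaussSum_sq (χ := (quadraticChar (ZMod p)).ringHomComp (Int.castRingHom ℂ))
    (R := ZMod p) (R' := ℂ) ?_ ((quadraticChar_isQuadratic (ZMod p)).comp _)
    (ZMod.isPrimitive_stdAddChar p)
  · simp only [gaussSum, MulChar.ringHomComp_apply, eq_intCast, hval] at hsq
    rw [hsq, ZMod.card, quadraticChar_neg_one hchar, ZMod.card, ZMod.χ₄_eq_neg_one_pow (by omega),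
      show p / 2 = h by omega]
    push_cast
    ring
  · rw [MulChar.ringHomComp_ne_one_iff Int.cast_injective]
    exact quadraticChar_ne_one hchar

theorem sum_stdAddChar_mul_sq {p : ℕ} [Fact p.Prime] (hp2 : p ≠ 2) {b : ZMod p} (hb : b ≠ 0) :
    ∑ x : ZMod p, ZMod.stdAddChar (b * x ^ 2) =
      (quadraticChar (ZMod p) b : ℂ) * (eps p * Real.sqrt p) := by
  have hchar : ringChar (ZMod p) ≠ 2 := by rwa [ZMod.ringChar_zmod_n]
  have hfib : ∑ x : ZMod p, (ZMod.stdAddChar (b * x ^ 2) : ℂ) =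
      ∑ y : ZMod p, ((quadraticChar (ZMod p) y : ℂ) + 1) * ZMod.stdAddChar (b * y) := by
    rw [← Finset.sum_fiberwise_of_maps_to (s := univ) (t := univ) (g := fun x : ZMod p => x ^ 2)
      (fun _ _ => mem_univ _)]
    refine sum_congr rfl fun y _ => ?_
    have h1 := quadraticChar_card_sqrts hchar y
    rw [sum_congr rfl (g := fun _ => (ZMod.stdAddChar (b * y) : ℂ)), sum_const, nsmul_eq_mul]
    · congr 1
      have h2 : ({x : ZMod p | x ^ 2 = y} : Set (ZMod p)).toFinset = univ.filter fun x => x ^ 2 = y := by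
        ext; simp
      rw [h2] at h1
      exact_mod_cast h1
    · intro x hx
      rw [(mem_filter.1 hx).2]
  rw [hfib]
  simp_rw [add_mul, one_mul]
  rw [sum_add_distrib]
  have hz : ∑ y : ZMod p, (ZMod.stdAddChar (b * y) : ℂ) = 0 := by
    have := AddChar.sum_mulShift b (ZMod.isPrimitive_stdAddChar p)
    rw [if_neg hb] at this
    simpa [mul_comm] using this
  rw [hz, add_zero, ← sum_quadraticChar_mul_stdAddChar hp2, mul_sum]
  rw [← Equiv.sum_comp (Equiv.mulLeft₀ b hb) (fun y => (quadraticChar (ZMod p) b : ℂ) *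
    ((quadraticChar (ZMod p) y : ℂ) * ZMod.stdAddChar y))]
  refine sum_congr rfl fun y _ => ?_
  have h1 : (quadraticChar (ZMod p) b : ℂ) ^ 2 = 1 := by exact_mod_cast quadraticChar_sq_one hb
  rw [show Equiv.mulLeft₀ b hb y = b * y from rfl, map_mul (quadraticChar (ZMod p))]
  push_cast
  linear_combination -(quadraticChar (ZMod p) y : ℂ) * ZMod.stdAddChar (b * y) * h1

theorem AddChar.exists_eq_stdAddChar_mul {N : ℕ} [NeZero N] (ψ : AddChar (ZMod N) ℂ) :
    ∃ μ : ZMod N, ∀ y, ψ y = ZMod.stdAddChar (μ * y) := by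
  have hprim : IsPrimitiveRoot (Complex.exp (2 * Real.pi * Complex.I / N)) N :=
    Complex.isPrimitiveRoot_exp N (NeZero.ne N)
  have h1 : ψ 1 ^ N = 1 := by
    rw [← AddChar.map_nsmul_eq_pow]
    simp
  obtain ⟨j, -, hj⟩ := hprim.eq_pow_of_pow_eq_one h1
  have hj' : ψ 1 = ZMod.stdAddChar (j : ZMod N) := by
    have := ZMod.stdAddChar_coe (N := N) j
    rw [Int.cast_natCast] at this
    rw [this, ← hj, ← Complex.exp_nat_mul]
    congr 1
    push_cast
    ring
  refine ⟨j, fun y => ?_⟩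
  rw [← ZMod.natCast_zmod_val y, ← nsmul_one, AddChar.map_nsmul_eq_pow, hj', nsmul_one,
    mul_comm, ← nsmul_eq_mul, AddChar.map_nsmul_eq_pow]

theorem ZMod.natCast_pow_self_eq_zero (p m : ℕ) : (p : ZMod (p ^ m)) ^ m = 0 := by
  rw [← Nat.cast_pow, ZMod.natCast_self]

theorem ZMod.card_natCast_pow_mul_eq_zero {p m i : ℕ} [NeZero (p ^ m)] (hi : i ≤ m) :
    #{y : ZMod (p ^ m) | (p : ZMod (p ^ m)) ^ i * y = 0} = p ^ i := by
  have := IsAddCyclic.card_nsmulAddMonoidHom_ker (ZMod (p ^ m)) (p ^ i)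
  rw [Nat.card_zmod, Nat.gcd_eq_right (pow_dvd_pow p hi)] at this
  rw [← this, Nat.card_eq_fintype_card, Fintype.card_subtype]
  congr 1
  ext y
  simp [AddMonoidHom.mem_ker]

section PrimePower

variable {p m : ℕ} [Fact p.Prime] [NeZero (p ^ m)]

theorem ZMod.prime_pow_mul_eq_zero {i : ℕ} (hi : i ≤ m) {x : ZMod (p ^ m)}
    (hx : (p : ZMod (p ^ m)) ^ i * x = 0) : ∃ z, x = (p : ZMod (p ^ m)) ^ (m - i) * z := by
  rw [← ZMod.natCast_zmod_val x, ← Nat.cast_pow, ← Nat.cast_mul, ZMod.natCast_eq_zero_iff] at hx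
  have h1 : p ^ (m - i) ∣ x.val := by
    apply Nat.dvd_of_mul_dvd_mul_left (pow_pos (Fact.out : p.Prime).pos i)
    rwa [← pow_add, Nat.add_sub_cancel' hi]
  obtain ⟨z, hz⟩ := h1
  refine ⟨z, ?_⟩
  rw [← ZMod.natCast_zmod_val x, hz]
  push_cast
  rfl

theorem ZMod.sum_prime_pow_mul {i : ℕ} (hi : i ≤ m) (F : ZMod (p ^ m) → ℂ) :
    ∑ y, F ((p : ZMod (p ^ m)) ^ i * y) =
      p ^ i * ∑ z, if (p : ZMod (p ^ m)) ^ (m - i) * z = 0 then F z else 0 := by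
  rw [← Finset.sum_fiberwise_of_maps_to (s := univ) (t := univ)
    (g := fun y : ZMod (p ^ m) => (p : ZMod (p ^ m)) ^ i * y) (fun _ _ => mem_univ _), mul_sum]
  refine sum_congr rfl fun z _ => ?_
  rw [sum_congr rfl (g := fun _ => F z) fun x hx => by rw [(mem_filter.1 hx).2], sum_const,
    nsmul_eq_mul]
  split_ifs with h
  · obtain ⟨y₀, hy₀⟩ := ZMod.prime_pow_mul_eq_zero (Nat.sub_le m i) h
    rw [Nat.sub_sub_self hi] at hy₀
    suffices hc : #{y : ZMod (p ^ m) | (p : ZMod (p ^ m)) ^ i * y = z} = p ^ i by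
      rw [hc, Nat.cast_pow]
    rw [← ZMod.card_natCast_pow_mul_eq_zero hi]
    apply Finset.card_bij (fun y _ => y - y₀)
    · intro y hy
      simp only [mem_filter, mem_univ, true_and] at hy ⊢
      rw [mul_sub, hy, ← hy₀, sub_self]
    · intro y _ y' _ h
      simpa using h
    · intro y hy
      simp only [mem_filter, mem_univ, true_and] at hy
      exact ⟨y + y₀, by simp [mul_add, hy, ← hy₀], by simp⟩
  · rw [Finset.filter_false_of_mem, card_empty]
    · simp
    · rintro y - rfl
      apply h
      rw [← mul_assoc, ← pow_add, Nat.sub_add_cancel hi, ZMod.natCast_pow_self_eq_zero, zero_mul]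

theorem ZMod.stdAddChar_prime_pow_mul (hm : 0 < m) (z : ZMod (p ^ m)) :
    (ZMod.stdAddChar ((p : ZMod (p ^ m)) ^ (m - 1) * z) : ℂ) =
      ZMod.stdAddChar (ZMod.castHom (dvd_pow_self p hm.ne') (ZMod p) z) := by
  have hp0 : (p : ℂ) ≠ 0 := by exact_mod_cast (Fact.out : p.Prime).ne_zero
  obtain ⟨z, rfl⟩ := ZMod.intCast_surjective z
  rw [map_intCast, ZMod.stdAddChar_coe]
  have := ZMod.stdAddChar_coe (N := p ^ m) (p ^ (m - 1) * z)
  push_cast at this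
  rw [this]
  congr 1
  obtain ⟨k, rfl⟩ : ∃ k, m = k + 1 := ⟨m - 1, by omega⟩
  rw [Nat.add_sub_cancel, pow_succ]
  field_simp

theorem ZMod.sum_comp_castHom (hm : 0 < m) (F : ZMod p → ℂ) :
    ∑ y : ZMod (p ^ m), F (ZMod.castHom (dvd_pow_self p hm.ne') (ZMod p) y) =
      p ^ (m - 1) * ∑ x, F x := by
  set φ := ZMod.castHom (dvd_pow_self p hm.ne') (ZMod p) with hφ
  have hsurj : Function.Surjective φ := ZMod.castHom_surjective _
  have hker : ∀ y : ZMod (p ^ m), φ y = 0 ↔ (p : ZMod (p ^ m)) ^ (m - 1) * y = 0 := by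
    intro y
    have := ZMod.stdAddChar_prime_pow_mul hm y
    rw [← hφ] at this
    rw [← ZMod.injective_stdAddChar.eq_iff, ← this, AddChar.map_zero_eq_one,
      ← AddChar.map_zero_eq_one (ZMod.stdAddChar (N := p ^ m)), ZMod.injective_stdAddChar.eq_iff]
  rw [← Finset.sum_fiberwise_of_maps_to (s := univ) (t := univ)
    (g := fun y : ZMod (p ^ m) => φ y) (fun _ _ => mem_univ _), mul_sum]
  refine sum_congr rfl fun z _ => ?_
  rw [sum_congr rfl (g := fun _ => F z) fun x hx => by rw [(mem_filter.1 hx).2], sum_const,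
    nsmul_eq_mul]
  congr 1
  rw [← Nat.cast_pow, ← ZMod.card_natCast_pow_mul_eq_zero (Nat.sub_le m 1)]
  congr 1
  obtain ⟨y₀, hy₀⟩ := hsurj z
  apply Finset.card_bij (fun y _ => y - y₀)
  · intro y hy
    simp only [mem_filter, mem_univ, true_and] at hy ⊢
    rw [← hker, map_sub, hy, hy₀, sub_self]
  · intro y _ y' _ h
    simpa using h
  · intro y hy
    simp only [mem_filter, mem_univ, true_and] at hy
    exact ⟨y + y₀, by simp [(hker y).2 hy, hy₀], by simp⟩

theorem ZMod.isUnit_of_castHom_ne_zero (hm : 0 < m) {x : ZMod (p ^ m)}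
    (hx : ZMod.castHom (dvd_pow_self p hm.ne') (ZMod p) x ≠ 0) : IsUnit x := by
  rw [← ZMod.natCast_zmod_val x, map_natCast, Ne, ZMod.natCast_eq_zero_iff] at hx
  rw [← ZMod.natCast_zmod_val x, ZMod.isUnit_iff_coprime]
  exact (((Fact.out : p.Prime).coprime_iff_not_dvd.2 hx).symm).pow_right m

theorem sum_stdAddChar_prime_pow_mul_sq (hp2 : p ≠ 2) (hm : 0 < m) {b : ZMod (p ^ m)}
    (hb : ZMod.castHom (dvd_pow_self p hm.ne') (ZMod p) b ≠ 0) :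
    ∑ y : ZMod (p ^ m), (ZMod.stdAddChar ((p : ZMod (p ^ m)) ^ (m - 1) * (b * y ^ 2)) : ℂ) =
      p ^ (m - 1) * ((quadraticChar (ZMod p)
        (ZMod.castHom (dvd_pow_self p hm.ne') (ZMod p) b) : ℂ) * (eps p * Real.sqrt p)) := by
  simp_rw [ZMod.stdAddChar_prime_pow_mul hm, map_mul (ZMod.castHom _ _), map_pow (ZMod.castHom _ _)]
  rw [ZMod.sum_comp_castHom hm (fun x => ZMod.stdAddChar (ZMod.castHom _ (ZMod p) b * x ^ 2)),
    sum_stdAddChar_mul_sq hp2 hb]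

end PrimePower

theorem ZMod.natCast_pow_mul_eq_zero {p m i : ℕ} (hi : m ≤ i) (x : ZMod (p ^ m)) :
    (p : ZMod (p ^ m)) ^ i * x = 0 := by
  rw [← Nat.sub_add_cancel hi, pow_add, ZMod.natCast_pow_self_eq_zero, mul_zero, zero_mul]

section OddExponent

variable {p n : ℕ} [NeZero (p ^ (2 * n + 1))]

theorem DirichletCharacter.exists_apply_one_add_pow_succ [Fact p.Prime]
    (χ : DirichletCharacter ℂ (p ^ (2 * n + 1))) :
    ∃ l : ZMod (p ^ (2 * n + 1)), ∀ t, χ (1 + p ^ (n + 1) * t) =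
      ZMod.stdAddChar ((p : ZMod (p ^ (2 * n + 1))) ^ (n + 1) * (l * t)) := by
  let ψ : AddChar (ZMod (p ^ (2 * n + 1))) ℂ :=
    { toFun := fun t => χ (1 + p ^ (n + 1) * t)
      map_zero_eq_one' := by simp
      map_add_eq_mul' := by
        intro s t
        rw [← map_mul]
        congr 1
        linear_combination -ZMod.natCast_pow_mul_eq_zero (show 2 * n + 1 ≤ 2 * (n + 1) by omega)
          (s * t) }
  obtain ⟨μ, hμ⟩ := ψ.exists_eq_stdAddChar_mul
  have hμ' : ∀ t, χ (1 + p ^ (n + 1) * t) = ZMod.stdAddChar (μ * t) := hμ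
  have h0 : (p : ZMod (p ^ (2 * n + 1))) ^ n * μ = 0 := by
    apply ZMod.injective_stdAddChar
    have h2 : (p : ZMod (p ^ (2 * n + 1))) ^ (n + 1) * (p : ZMod (p ^ (2 * n + 1))) ^ n = 0 := by
      linear_combination ZMod.natCast_pow_mul_eq_zero (le_refl (2 * n + 1))
        (1 : ZMod (p ^ (2 * n + 1)))
    rw [mul_comm _ μ, ← hμ', AddChar.map_zero_eq_one, h2, add_zero, map_one]
  obtain ⟨l, hl⟩ := ZMod.prime_pow_mul_eq_zero (by omega) h0
  refine ⟨l, fun t => ?_⟩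
  rw [hμ', hl, show 2 * n + 1 - n = n + 1 by omega, mul_assoc]

theorem DirichletCharacter.exists_apply_one_add_pow [Fact p.Prime] (hn : 1 ≤ n)
    {χ : DirichletCharacter ℂ (p ^ (2 * n + 1))} {l h : ZMod (p ^ (2 * n + 1))}
    (hl : ∀ t, χ (1 + p ^ (n + 1) * t) =
      ZMod.stdAddChar ((p : ZMod (p ^ (2 * n + 1))) ^ (n + 1) * (l * t)))
    (hlu : IsUnit l) (hh : 2 * h = 1) :
    ∃ w : ZMod (p ^ (2 * n + 1)), ∀ y,
      χ (1 + p ^ n * y) * ZMod.stdAddChar (-l * ((p : ZMod (p ^ (2 * n + 1))) ^ n * y)) =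
      ZMod.stdAddChar ((p : ZMod (p ^ (2 * n + 1))) ^ (2 * n) * (-(h * l) * ((y + w) ^ 2 - w ^ 2))) := by
  set P : ZMod (p ^ (2 * n + 1)) := (p : ZMod (p ^ (2 * n + 1))) with hP
  have hadd : ∀ y z, χ (1 + P ^ n * y) * χ (1 + P ^ n * z) =
      χ (1 + P ^ n * (y + z)) * ZMod.stdAddChar (P ^ (2 * n) * (l * (y * z))) := by
    intro y z
    have h1 := hl (P ^ (n - 1) * (y * z))
    have h2 : P ^ (n + 1) * P ^ (n - 1) = P ^ (2 * n) := by
      rw [← pow_add]; congr 1; omega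
    rw [← mul_assoc, h2, show P ^ (n + 1) * (l * (P ^ (n - 1) * (y * z))) =
      P ^ (2 * n) * (l * (y * z)) by rw [← h2]; ring] at h1
    rw [← h1, ← map_mul, ← map_mul]
    congr 1
    linear_combination -ZMod.natCast_pow_mul_eq_zero (show 2 * n + 1 ≤ 3 * n by omega)
      ((y + z) * (y * z))
  let ψ : AddChar (ZMod (p ^ (2 * n + 1))) ℂ :=
    { toFun := fun y => χ (1 + P ^ n * y) * ZMod.stdAddChar (P ^ (2 * n) * (h * l * y ^ 2))
      map_zero_eq_one' := by simp
      map_add_eq_mul' := by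
        intro y z
        have h1 : P ^ (2 * n) * (h * l * (y + z) ^ 2) = P ^ (2 * n) * (l * (y * z)) +
          P ^ (2 * n) * (h * l * y ^ 2) + P ^ (2 * n) * (h * l * z ^ 2) := by
          linear_combination P ^ (2 * n) * l * y * z * hh
        rw [h1, AddChar.map_add_eq_mul, AddChar.map_add_eq_mul]
        linear_combination -ZMod.stdAddChar (P ^ (2 * n) * (h * l * y ^ 2)) *
          ZMod.stdAddChar (P ^ (2 * n) * (h * l * z ^ 2)) * hadd y z }
  obtain ⟨μ, hμ⟩ := ψ.exists_eq_stdAddChar_mul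
  have hμ' : ∀ y, χ (1 + P ^ n * y) * ZMod.stdAddChar (P ^ (2 * n) * (h * l * y ^ 2)) =
    ZMod.stdAddChar (μ * y) := hμ
  have h0 : P ^ 1 * (μ - P ^ n * l) = 0 := by
    have h1 := hμ' P
    have h2 := hl 1
    rw [mul_one, pow_succ P n] at h2
    rw [h2, ← AddChar.map_add_eq_mul, ZMod.injective_stdAddChar.eq_iff] at h1
    linear_combination -h1 + ZMod.natCast_pow_mul_eq_zero (show 2 * n + 1 ≤ 2 * n + 2 by omega) (h * l)
  obtain ⟨v, hv⟩ := ZMod.prime_pow_mul_eq_zero (by omega) h0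
  rw [Nat.add_sub_cancel, ← hP] at hv
  obtain ⟨l', hl'⟩ := hlu.exists_right_inv
  refine ⟨-v * l', fun y => ?_⟩
  have h1 : χ (1 + P ^ n * y) * ZMod.stdAddChar (P ^ (2 * n) * (h * l * y ^ 2)) *
      ZMod.stdAddChar (-(P ^ (2 * n) * (h * l * y ^ 2))) = χ (1 + P ^ n * y) := by
    rw [mul_assoc, ← AddChar.map_add_eq_mul, add_neg_cancel, AddChar.map_zero_eq_one, mul_one]
  rw [← h1, hμ', ← AddChar.map_add_eq_mul, ← AddChar.map_add_eq_mul]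
  congr 1
  linear_combination y * hv - P ^ (2 * n) * y * v * hh - P ^ (2 * n) * 2 * h * y * v * hl'

theorem DirichletCharacter.gaussSum_pow_eq_sum_ite
    {χ : DirichletCharacter ℂ (p ^ (2 * n + 1))} {l : ZMod (p ^ (2 * n + 1))}
    (hl : ∀ t, χ (1 + p ^ (n + 1) * t) =
      ZMod.stdAddChar ((p : ZMod (p ^ (2 * n + 1))) ^ (n + 1) * (l * t))) (c : ℕ) :
    gaussSum (χ ^ c) ZMod.stdAddChar = ∑ x : ZMod (p ^ (2 * n + 1)),
      if (p : ZMod (p ^ (2 * n + 1))) ^ (n + 1) * (x + (c : ZMod (p ^ (2 * n + 1))) * l) = 0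
        then (χ ^ c) x * ZMod.stdAddChar x else 0 := by
  set P : ZMod (p ^ (2 * n + 1)) := (p : ZMod (p ^ (2 * n + 1))) with hP
  have hunit : ∀ t, (1 + P ^ (n + 1) * t) * (1 - P ^ (n + 1) * t) = 1 := by
    intro t
    linear_combination -ZMod.natCast_pow_mul_eq_zero (show 2 * n + 1 ≤ 2 * (n + 1) by omega) (t ^ 2)
  have hshift : ∀ t, gaussSum (χ ^ c) ZMod.stdAddChar = ∑ x : ZMod (p ^ (2 * n + 1)),
      (χ ^ c) x * ZMod.stdAddChar x * ZMod.stdAddChar (t * (P ^ (n + 1) * (x + (c : ZMod (p ^ (2 * n + 1))) * l))) := by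
    intro t
    let u : (ZMod (p ^ (2 * n + 1)))ˣ := ⟨1 + P ^ (n + 1) * t, 1 - P ^ (n + 1) * t, hunit t,
      (mul_comm _ _).trans (hunit t)⟩
    rw [gaussSum, ← Equiv.sum_comp u.mulRight]
    refine sum_congr rfl fun x _ => ?_
    rw [show u.mulRight x = x * (1 + P ^ (n + 1) * t) from rfl, map_mul (χ ^ c)]
    rw [MulChar.pow_apply_coe χ c u |> fun h => (h : (χ ^ c) (1 + P ^ (n + 1) * t) =
      χ (1 + P ^ (n + 1) * t) ^ c), hl, ← AddChar.map_nsmul_eq_pow, mul_assoc, mul_assoc,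
      ← AddChar.map_add_eq_mul, ← AddChar.map_add_eq_mul]
    congr 2
    rw [nsmul_eq_mul]
    ring
  have hq : ((p ^ (2 * n + 1) : ℕ) : ℂ) ≠ 0 := Nat.cast_ne_zero.2 (NeZero.ne _)
  apply mul_left_cancel₀ hq
  calc ((p ^ (2 * n + 1) : ℕ) : ℂ) * gaussSum (χ ^ c) ZMod.stdAddChar
      = ∑ t : ZMod (p ^ (2 * n + 1)), gaussSum (χ ^ c) ZMod.stdAddChar := by
        rw [sum_const, card_univ, ZMod.card, nsmul_eq_mul]
    _ = _ := by
      rw [sum_congr rfl fun t _ => hshift t, sum_comm, mul_sum]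
      refine sum_congr rfl fun x _ => ?_
      rw [← mul_sum, AddChar.sum_mulShift _ (ZMod.isPrimitive_stdAddChar _), ZMod.card]
      split_ifs <;> simp [mul_comm]

end OddExponent

theorem DirichletCharacter.exists_gaussSum_pow_eq {p n : ℕ} [Fact p.Prime]
    [NeZero (p ^ (2 * n + 1))] (hp2 : p ≠ 2) (hn : 1 ≤ n)
    {χ : DirichletCharacter ℂ (p ^ (2 * n + 1))} {r : ℤ}
    (hr : χ (1 + p ^ (2 * n) * r) = ZMod.stdAddChar ((p : ZMod (p ^ (2 * n + 1))) ^ (2 * n))) :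
    (r : ZMod p) ≠ 0 ∧ ∃ W : ℂ, W ≠ 0 ∧ ∀ c : ℕ, ¬ p ∣ c → gaussSum (χ ^ c) ZMod.stdAddChar =
      W ^ c * (χ ^ c) c *
        (p ^ n * ((quadraticChar (ZMod p) (-2 * r * c) : ℂ) * (eps p * Real.sqrt p))) := by
  set P : ZMod (p ^ (2 * n + 1)) := (p : ZMod (p ^ (2 * n + 1))) with hP
  have hpos : 0 < 2 * n + 1 := Nat.succ_pos _
  set π := ZMod.castHom (dvd_pow_self p hpos.ne') (ZMod p) with hπ
  have h2p : (2 : ZMod p) ≠ 0 := by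
    have : ((2 : ℕ) : ZMod p) ≠ 0 := by
      rw [Ne, ZMod.natCast_eq_zero_iff]
      intro h
      exact hp2 ((Nat.prime_dvd_prime_iff_eq Fact.out Nat.prime_two).1 h)
    exact_mod_cast this
  obtain ⟨l, hl⟩ := χ.exists_apply_one_add_pow_succ
  have hlr : π l * r = 1 := by
    have h1 := hl (P ^ (n - 1) * r)
    have h2 : P ^ (n + 1) * P ^ (n - 1) = P ^ (2 * n) := by
      rw [← pow_add]; congr 1; omega
    rw [← mul_assoc, h2, hr, show P ^ (n + 1) * (l * (P ^ (n - 1) * (r : ZMod (p ^ (2 * n + 1))))) =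
      P ^ (2 * n) * (l * r) by rw [← h2]; ring] at h1
    have h3 := ZMod.stdAddChar_prime_pow_mul hpos (1 : ZMod (p ^ (2 * n + 1)))
    have h4 := ZMod.stdAddChar_prime_pow_mul hpos (l * (r : ZMod (p ^ (2 * n + 1))))
    rw [Nat.add_sub_cancel] at h3 h4
    rw [mul_one] at h3
    have h5 := ZMod.injective_stdAddChar ((h3.symm.trans h1).trans h4)
    rw [map_one, map_mul, map_intCast] at h5
    exact h5.symm
  have hl0 : π l ≠ 0 := left_ne_zero_of_mul_eq_one hlr
  have hlu : IsUnit l := ZMod.isUnit_of_castHom_ne_zero hpos hl0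
  obtain ⟨h, hh⟩ := (ZMod.isUnit_of_castHom_ne_zero hpos
    (show π 2 ≠ 0 by rwa [map_ofNat])).exists_right_inv
  obtain ⟨w, hw⟩ := χ.exists_apply_one_add_pow hn hl hlu hh
  have he0 : ∀ x : ZMod (p ^ (2 * n + 1)), ZMod.stdAddChar x ≠ 0 := fun x =>
    (ZMod.stdAddChar.val_isUnit x).ne_zero
  refine ⟨right_ne_zero_of_mul_eq_one hlr, χ (-l) * ZMod.stdAddChar (-l) * ZMod.stdAddChar (P ^ (2 * n) * (h * l * w ^ 2)),
    mul_ne_zero (mul_ne_zero ((hlu.neg.map χ).ne_zero) (he0 _)) (he0 _), fun c hc => ?_⟩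
  have hc0 : c ≠ 0 := by rintro rfl; exact hc (dvd_zero p)
  have hcp : (c : ZMod p) ≠ 0 := by rwa [Ne, ZMod.natCast_eq_zero_iff]
  have hcu : IsUnit (c : ZMod (p ^ (2 * n + 1))) :=
    ZMod.isUnit_of_castHom_ne_zero hpos (by rwa [map_natCast])
  have hCπ : π (c : ZMod (p ^ (2 * n + 1))) = c := map_natCast π c
  set C : ZMod (p ^ (2 * n + 1)) := (c : ZMod (p ^ (2 * n + 1))) with hC
  obtain ⟨u, hu⟩ := (hcu.mul hlu).neg
  set η : ZMod (p ^ (2 * n + 1)) := (u : ZMod (p ^ (2 * n + 1)))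
  have hη : η = -(C * l) := hu
  have hterm : ∀ y : ZMod (p ^ (2 * n + 1)),
      (χ ^ c) (η * (1 + P ^ n * y)) * ZMod.stdAddChar (η * (1 + P ^ n * y)) =
      (χ (-l) * ZMod.stdAddChar (-l) * ZMod.stdAddChar (P ^ (2 * n) * (h * l * w ^ 2))) ^ c *
        (χ ^ c) C * ZMod.stdAddChar (P ^ (2 * n) * (-(C * h * l) * (y + w) ^ 2)) := by
    intro y
    have h1 : ZMod.stdAddChar (η * (1 + P ^ n * y)) =
        ZMod.stdAddChar (-l) ^ c * ZMod.stdAddChar (-l * (P ^ n * y)) ^ c := by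
      rw [← AddChar.map_nsmul_eq_pow, ← AddChar.map_nsmul_eq_pow, ← AddChar.map_add_eq_mul, hη,
        nsmul_eq_mul, nsmul_eq_mul, ← hC]
      congr 1
      ring
    have h2 : (χ ^ c) (η * (1 + P ^ n * y)) =
        χ C ^ c * χ (-l) ^ c * χ (1 + P ^ n * y) ^ c := by
      rw [MulChar.pow_apply' χ hc0, hη, ← mul_pow, ← mul_pow, ← map_mul, ← map_mul]
      congr 2
      ring
    have h3 := congrArg (· ^ c) (hw y)
    simp only [mul_pow] at h3
    have h4 : ZMod.stdAddChar (P ^ (2 * n) * (-(h * l) * ((y + w) ^ 2 - w ^ 2))) ^ c =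
        ZMod.stdAddChar (P ^ (2 * n) * (h * l * w ^ 2)) ^ c *
          ZMod.stdAddChar (P ^ (2 * n) * (-(C * h * l) * (y + w) ^ 2)) := by
      rw [← AddChar.map_nsmul_eq_pow, ← AddChar.map_nsmul_eq_pow, ← AddChar.map_add_eq_mul,
        nsmul_eq_mul, nsmul_eq_mul, ← hC]
      congr 1
      ring
    rw [h1, h2, MulChar.pow_apply' χ hc0]
    rw [← hP, h4] at h3
    simp only [mul_pow]
    linear_combination χ C ^ c * χ (-l) ^ c * ZMod.stdAddChar (-l) ^ c * h3
  have hpn : (p : ℂ) ^ n ≠ 0 := pow_ne_zero _ (Nat.cast_ne_zero.2 (Fact.out : p.Prime).ne_zero)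
  have hG : (p : ℂ) ^ n * gaussSum (χ ^ c) ZMod.stdAddChar = ∑ y : ZMod (p ^ (2 * n + 1)),
      (χ ^ c) (η * (1 + P ^ n * y)) * ZMod.stdAddChar (η * (1 + P ^ n * y)) := by
    rw [ZMod.sum_prime_pow_mul (show n ≤ 2 * n + 1 by omega)
      (fun z => (χ ^ c) (η * (1 + z)) * ZMod.stdAddChar (η * (1 + z))),
      χ.gaussSum_pow_eq_sum_ite hl c, show 2 * n + 1 - n = n + 1 by omega,
      ← Equiv.sum_comp ((Equiv.addLeft 1).trans u.mulLeft)]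
    congr 1
    refine sum_congr rfl fun z _ => ?_
    have h1 : ((Equiv.addLeft 1).trans u.mulLeft) z = η * (1 + z) := rfl
    have h2 : P ^ (n + 1) * (η * (1 + z) + C * l) =
        η * (P ^ (n + 1) * z) := by
      rw [hη]; ring
    rw [h1, h2]
    exact if_congr u.mul_right_eq_zero rfl rfl
  apply mul_left_cancel₀ hpn
  have hshift : ∑ y, ZMod.stdAddChar (P ^ (2 * n) * (-(C * h * l) * (y + w) ^ 2)) =
      ∑ y, ZMod.stdAddChar (P ^ (2 * n) * (-(C * h * l) * y ^ 2)) :=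
    Equiv.sum_comp (Equiv.addRight w)
      (fun y => ZMod.stdAddChar (P ^ (2 * n) * (-(C * h * l) * y ^ 2)))
  rw [hG, sum_congr rfl fun y _ => hterm y, ← mul_sum, hshift]
  have hπh : 2 * π h = 1 := by
    have := congrArg π hh
    rwa [map_mul, map_one, map_ofNat] at this
  have hb : π (-(C * h * l)) = -(c * π h * π l) := by
    rw [map_neg, map_mul, map_mul, hCπ]
  have hb0 : π (-(C * h * l)) ≠ 0 := by
    rw [hb]
    exact neg_ne_zero.2 (mul_ne_zero (mul_ne_zero hcp (right_ne_zero_of_mul_eq_one hπh)) hl0)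
  have hsq : quadraticChar (ZMod p) (π (-(C * h * l))) = quadraticChar (ZMod p) (-2 * r * c) := by
    have h1 : -2 * (r : ZMod p) * c = π (-(C * h * l)) * (2 * r) ^ 2 := by
      rw [hb]
      linear_combination (2 * r * c : ZMod p) * (2 * π h * hlr + hπh)
    have hr0 : (r : ZMod p) ≠ 0 := right_ne_zero_of_mul_eq_one hlr
    rw [h1, map_mul, quadraticChar_sq_one' (mul_ne_zero h2p hr0), mul_one]
  have hS := sum_stdAddChar_prime_pow_mul_sq hp2 hpos hb0
  rw [Nat.add_sub_cancel, hsq] at hS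
  rw [hS]
  ring

theorem MulChar.prod_apply_of_nonempty {R R' ι : Type*} [CommMonoid R] [CommMonoidWithZero R']
    {s : Finset ι} (hs : s.Nonempty) (χ : ι → MulChar R R') (x : R) :
    (∏ i ∈ s, χ i) x = ∏ i ∈ s, χ i x := by
  induction hs using Finset.Nonempty.cons_induction with
  | singleton i => simp
  | cons i s hi _ ih => rw [prod_cons, prod_cons, MulChar.mul_apply, ih]

theorem AddChar.map_sum_eq_prod_map {A M ι : Type*} [AddCommMonoid A] [CommMonoid M]
    (ψ : AddChar A M) (s : Finset ι) (f : ι → A) : ψ (∑ i ∈ s, f i) = ∏ i ∈ s, ψ (f i) := by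
  classical
  induction s using Finset.induction_on with
  | empty => simp
  | insert i s hi ih => rw [sum_insert hi, prod_insert hi, ψ.map_add_eq_mul, ih]

theorem Jsum_mul_gaussSum {q k : ℕ} [NeZero q] [NeZero k] {χ : Fin k → DirichletCharacter ℂ q}
    (hχ : ∀ i, (χ i).IsPrimitive) (hprod : (∏ i, χ i).IsPrimitive) :
    Jsum χ 1 * gaussSum (∏ i, χ i) ZMod.stdAddChar = ∏ i, gaussSum (χ i) ZMod.stdAddChar := by
  have hne : (univ : Finset (Fin k)).Nonempty := ⟨0, mem_univ 0⟩
  have hJ : ∀ t, ZMod.dft (Jsum χ) t = ∏ i, ZMod.dft (χ i) t := by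
    intro t
    simp only [ZMod.dft_apply, smul_eq_mul, Jsum, mul_sum]
    rw [sum_comm, Finset.prod_univ_sum, Fintype.piFinset_univ]
    refine sum_congr rfl fun x _ => ?_
    rw [sum_eq_single (∑ i, x i) (fun b _ hb => by rw [if_neg hb.symm, mul_zero])
      (fun h => absurd (mem_univ _) h), if_pos rfl, prod_mul_distrib, sum_mul, ← sum_neg_distrib]
    rw [AddChar.map_sum_eq_prod_map]
  have hfun : gaussSum (∏ i, χ i) ZMod.stdAddChar • Jsum χ =
      (∏ i, gaussSum (χ i) ZMod.stdAddChar) • ⇑(∏ i, χ i) := by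
    apply ZMod.dft.injective
    rw [map_smul, map_smul]
    funext t
    rw [Pi.smul_apply, Pi.smul_apply, hJ, hprod.fourierTransform_eq_inv_mul_gaussSum,
      ← prod_inv_distrib, MulChar.prod_apply_of_nonempty hne,
      prod_congr rfl fun i _ => (hχ i).fourierTransform_eq_inv_mul_gaussSum t, prod_mul_distrib,
      smul_eq_mul, smul_eq_mul]
    ring
  have h1 := congrFun hfun 1
  rwa [Pi.smul_apply, Pi.smul_apply, map_one, smul_eq_mul, smul_eq_mul, mul_one, mul_comm] at h1

theorem DirichletCharacter.not_isPrimitive_pow_of_dvd {p m c : ℕ} [Fact p.Prime]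
    [NeZero (p ^ m)] (hm : 2 ≤ m) (χ : DirichletCharacter ℂ (p ^ m)) (hc : p ∣ c) :
    ¬ (χ ^ c).IsPrimitive := by
  intro hprim
  have hp : p.Prime := Fact.out
  have hdvd : p ^ (m - 1) ∣ p ^ m := pow_dvd_pow p (Nat.sub_le m 1)
  have hfac : (χ ^ c).FactorsThrough (p ^ (m - 1)) := by
    rw [factorsThrough_iff_ker_unitsMap hdvd]
    intro u hu
    have hu1 : ZMod.castHom hdvd (ZMod (p ^ (m - 1))) (u : ZMod (p ^ m)) = 1 := by
      have := congrArg Units.val hu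
      simpa [ZMod.unitsMap] using this
    obtain ⟨b, hb⟩ := ZMod.intCast_surjective (u : ZMod (p ^ m))
    rw [← hb, map_intCast, ← Int.cast_one, ZMod.intCast_eq_intCast_iff_dvd_sub] at hu1
    obtain ⟨z, hz⟩ := (dvd_sub_comm).1 hu1
    have hb' : b = 1 + p ^ (m - 1) * z := by push_cast at hz; linarith
    obtain ⟨s, hs⟩ := exists_add_pow_prime_eq hp 1 ((p : ZMod (p ^ m)) ^ (m - 1) * z)
    have hup : u ^ p = 1 := by
      apply Units.ext
      rw [Units.val_pow_eq_pow_val, ← hb, hb']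
      push_cast
      rw [hs, mul_pow, ← pow_mul,
        ZMod.natCast_pow_mul_eq_zero (by nlinarith [hp.two_le, Nat.sub_add_cancel (by omega : 1 ≤ m)])]
      have h1 : (p : ZMod (p ^ m)) * p ^ (m - 1) = 0 := by
        rw [← pow_succ', Nat.sub_add_cancel (by omega), ZMod.natCast_pow_self_eq_zero]
      linear_combination (z * s : ZMod (p ^ m)) * h1
    obtain ⟨d, rfl⟩ := hc
    rw [MonoidHom.mem_ker]
    apply Units.ext
    rw [MulChar.coe_toUnitHom, MulChar.pow_apply_coe, pow_mul, ← map_pow, ← Units.val_pow_eq_pow_val,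
      hup, Units.val_one, map_one, one_pow, Units.val_one]
  have h1 : (χ ^ c).conductor ≤ p ^ (m - 1) := Nat.sInf_le hfac
  rw [(isPrimitive_def _).1 hprim] at h1
  exact absurd h1 (not_le.2 (Nat.pow_lt_pow_right hp.one_lt (by omega)))

theorem exists_one_add_pow_eq {R : Type*} [CommRing R] (y : R) (n : ℕ) :
    ∃ K, (1 + y) ^ n = 1 + n * y + n.choose 2 * y ^ 2 + y ^ 3 * K := by
  induction n with
  | zero => exact ⟨0, by simp⟩
  | succ n ih =>
    obtain ⟨K, hK⟩ := ih
    refine ⟨K * (1 + y) + n.choose 2, ?_⟩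
    rw [pow_succ, hK, Nat.choose_succ_succ n 1, Nat.choose_one_right]
    push_cast
    ring

theorem Int.exists_pow_sub_one_mul_prime_pow_eq {p : ℕ} (hp : p.Prime) (hp2 : p ≠ 2) {a r : ℤ}
    (h : a ^ (p - 1) = 1 + r * p) (j : ℕ) :
    ∃ s, a ^ ((p - 1) * p ^ j) = 1 + p ^ (j + 1) * (r + p * s) := by
  induction j with
  | zero => exact ⟨0, by rw [pow_zero, mul_one, h]; ring⟩
  | succ j ih =>
    obtain ⟨s, hs⟩ := ih
    obtain ⟨K, hK⟩ := exists_one_add_pow_eq ((p : ℤ) ^ (j + 1) * (r + p * s)) p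
    obtain ⟨d, hd⟩ := hp.dvd_choose_self two_ne_zero (lt_of_le_of_ne hp.two_le hp2.symm)
    refine ⟨s + d * p ^ j * (r + p * s) ^ 2 + p ^ (2 * j) * (r + p * s) ^ 3 * K, ?_⟩
    rw [pow_succ p j, ← mul_assoc, pow_mul, hs, hK, hd]
    push_cast
    ring

theorem DirichletCharacter.apply_one_add_prime_pow_mul {p m : ℕ} [NeZero (p ^ m)] (hp : p.Prime)
    (hp2 : p ≠ 2) (hm : 2 ≤ m) {a : ℕ} {r : ℤ} (h : (a : ℤ) ^ (p - 1) = 1 + r * p)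
    {χ : DirichletCharacter ℂ (p ^ m)}
    (ha : χ a = Complex.exp (2 * Real.pi * Complex.I / (Nat.totient (p ^ m)))) :
    χ (1 + p ^ (m - 1) * r) = ZMod.stdAddChar ((p : ZMod (p ^ m)) ^ (m - 1)) := by
  obtain ⟨s, hs⟩ := Int.exists_pow_sub_one_mul_prime_pow_eq hp hp2 h (m - 2)
  have hm1 : m - 2 + 1 = m - 1 := by omega
  have h1 : (1 + p ^ (m - 1) * r : ZMod (p ^ m)) = (a : ZMod (p ^ m)) ^ ((p - 1) * p ^ (m - 2)) := by
    have h2 := congrArg (Int.cast : ℤ → ZMod (p ^ m)) hs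
    push_cast at h2
    have h3 : (p : ZMod (p ^ m)) ^ (m - 1) * p = 0 := by
      rw [← pow_succ, Nat.sub_add_cancel (by omega), ZMod.natCast_pow_self_eq_zero]
    rw [h2, hm1]
    linear_combination -(s : ZMod (p ^ m)) * h3
  have h4 : ((p : ZMod (p ^ m)) ^ (m - 1)) = (((p ^ (m - 1) : ℕ) : ℤ) : ZMod (p ^ m)) := by
    push_cast; rfl
  have hp0 : (p : ℂ) ≠ 0 := Nat.cast_ne_zero.2 hp.ne_zero
  have hp1 : ((p - 1 : ℕ) : ℂ) ≠ 0 := Nat.cast_ne_zero.2 (Nat.sub_ne_zero_of_lt hp.one_lt)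
  rw [h1, map_pow, ha, ← Complex.exp_nat_mul, h4, ZMod.stdAddChar_coe,
    Nat.totient_prime_pow hp (by omega)]
  congr 1
  obtain ⟨j, rfl⟩ := Nat.exists_eq_add_of_le hm
  rw [show 2 + j - 1 = j + 1 by omega, show 2 + j - 2 = j by omega]
  push_cast
  field_simp
  ring

theorem DirichletCharacter.exists_forall_eq_pow {N : ℕ} [NeZero N] {a : ℕ}
    (ha : orderOf (a : ZMod N) = N.totient) :
    ∃ ψ : DirichletCharacter ℂ N,
      ψ a = Complex.exp (2 * Real.pi * Complex.I / N.totient) ∧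
      ∀ (χ : DirichletCharacter ℂ N) (c : ℕ),
        χ a = Complex.exp (2 * Real.pi * Complex.I * c / N.totient) → χ = ψ ^ c := by
  have hφ : N.totient ≠ 0 := (Nat.totient_pos.2 (NeZero.pos N)).ne'
  have hpow : (a : ZMod N) ^ N.totient = 1 := by rw [← ha, pow_orderOf_eq_one]
  obtain ⟨g, hga⟩ := IsUnit.of_pow_eq_one hpow hφ
  have hg : ∀ x, x ∈ Subgroup.zpowers g := by
    have htop : Subgroup.zpowers g = ⊤ := by
      apply Subgroup.eq_top_of_card_eq
      rw [Nat.card_zpowers, ← orderOf_units, hga, ha, Nat.card_eq_fintype_card,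
        ZMod.card_units_eq_totient]
    exact fun x => htop ▸ Subgroup.mem_top x
  have hζ := Complex.isPrimitiveRoot_exp _ hφ
  have hmem : (hζ.isUnit hφ).unit ∈ rootsOfUnity (Fintype.card (ZMod N)ˣ) ℂ := by
    rw [ZMod.card_units_eq_totient, _root_.mem_rootsOfUnity]
    apply Units.ext
    rw [Units.val_pow_eq_pow_val, IsUnit.unit_spec, Units.val_one, hζ.pow_eq_one]
  have hψ : MulChar.ofRootOfUnity hmem hg a =
      Complex.exp (2 * Real.pi * Complex.I / N.totient) := by
    rw [← hga]
    exact MulChar.ofRootOfUnity_spec hmem hg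
  refine ⟨MulChar.ofRootOfUnity hmem hg, hψ, fun χ c hχ => ?_⟩
  rw [MulChar.eq_iff hg, MulChar.pow_apply_coe, hga, hχ, hψ, ← Complex.exp_nat_mul]
  congr 1
  ring

end

theorem stmt4 {p m k : ℕ} [NeZero (p ^ m)] (hp : p.Prime) (hp2 : p ≠ 2)
    (hk : 2 ≤ k) (hm : 3 ≤ m) (hmodd : Odd m)
    -- a primitive root a mod p^m
    (a : ℕ) (ha : orderOf (a : ZMod (p ^ m)) = Nat.totient (p ^ m))
    -- r with a^(p-1) = 1 + r p
    (r : ℤ) (hr : (a : ℤ) ^ (p - 1) = 1 + r * p)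
    (χ : Fin k → DirichletCharacter ℂ (p ^ m))
    -- the c_i with χ_i(a) = e(c_i/φ(p^m)), 1 ≤ c_i ≤ φ(p^m)
    (c : Fin k → ℕ) (hcrange : ∀ i, 1 ≤ c i ∧ c i ≤ Nat.totient (p ^ m))
    (hχa : ∀ i, χ i (a : ZMod (p ^ m)) =
      Complex.exp (2 * Real.pi * Complex.I * (c i) / (Nat.totient (p ^ m))))
    (hprim : ∀ i, (χ i).IsPrimitive)
    (hprodprim : (∏ i, χ i).IsPrimitive)
    (v : ℕ) (hv : v = ∑ i, c i) :
    Jsum χ (1 : ZMod (p ^ m)) =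
      (Real.sqrt p : ℂ) ^ (m * (k - 1)) *
        (∏ i, χ i ((c i : ZMod (p ^ m)))) *
        ((∏ i, χ i) ((v : ZMod (p ^ m))))⁻¹ *
        (jacobiSym (-2 * r) p : ℂ) ^ (k - 1) *
        (jacobiSym ((v : ℤ) * ∏ i, (c i : ℤ)) p : ℂ) *
        eps p ^ (k - 1) := by
  have : Fact p.Prime := ⟨hp⟩
  obtain ⟨k, rfl⟩ := Nat.exists_eq_add_of_le' (show 1 ≤ k by omega)
  obtain ⟨n, rfl⟩ := hmodd
  have hn : 1 ≤ n := by omega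
  obtain ⟨ψ, hψa, hψ⟩ := DirichletCharacter.exists_forall_eq_pow ha
  have hχ : ∀ i, χ i = ψ ^ c i := fun i => hψ (χ i) (c i) (hχa i)
  have hprod : ∏ i, χ i = ψ ^ v := by
    rw [Finset.prod_congr rfl fun i _ => hχ i, Finset.prod_pow_eq_pow_sum, hv]
  have hndvd : ∀ {d : ℕ}, (ψ ^ d).IsPrimitive → ¬ p ∣ d := fun h hd =>
    ψ.not_isPrimitive_pow_of_dvd (by omega) hd h
  have hci : ∀ i, ¬ p ∣ c i := fun i => hndvd (hχ i ▸ hprim i)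
  have hvp : ¬ p ∣ v := hndvd (hprod ▸ hprodprim)
  have hψr := DirichletCharacter.apply_one_add_prime_pow_mul hp hp2 (by omega) hr hψa
  rw [Nat.add_sub_cancel] at hψr
  obtain ⟨hr0, W, hW, hG⟩ := DirichletCharacter.exists_gaussSum_pow_eq hp2 hn hψr
  have hJ := Jsum_mul_gaussSum hprim hprodprim
  have hleg : ∀ x : ℤ, jacobiSym x p = quadraticChar (ZMod p) x := fun x => by
    rw [← jacobiSym.legendreSym.to_jacobiSym]; rfl
  have h2p : (-2 : ZMod p) ≠ 0 := by
    rw [neg_ne_zero]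
    have : ((2 : ℕ) : ZMod p) ≠ 0 := by
      rw [Ne, ZMod.natCast_eq_zero_iff]
      exact fun h => hp2 ((Nat.prime_dvd_prime_iff_eq hp Nat.prime_two).1 h)
    exact_mod_cast this
  have hv0 : (v : ZMod p) ≠ 0 := by rwa [Ne, ZMod.natCast_eq_zero_iff]
  have hQ : ∀ d : ℕ, (quadraticChar (ZMod p) (-2 * r * d) : ℂ) =
      (jacobiSym (-2 * r) p : ℂ) * (quadraticChar (ZMod p) d : ℂ) := fun d => by
    rw [hleg, map_mul]
    push_cast
    rfl
  have hL : (jacobiSym (-2 * r) p : ℂ) ^ 2 = 1 := by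
    have h := quadraticChar_sq_one (mul_ne_zero h2p hr0)
    rw [hleg]
    push_cast
    exact_mod_cast h
  have hLv : (quadraticChar (ZMod p) v : ℂ) ^ 2 = 1 := by
    exact_mod_cast quadraticChar_sq_one hv0
  have hLc : (jacobiSym ((v : ℤ) * ∏ i, (c i : ℤ)) p : ℂ) =
      (quadraticChar (ZMod p) v : ℂ) * ∏ i, (quadraticChar (ZMod p) (c i) : ℂ) := by
    rw [hleg]
    push_cast
    rw [map_mul, map_prod]
    push_cast
    rfl
  have heps : eps p ≠ 0 := by
    rw [eps]
    split_ifs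
    · exact one_ne_zero
    · exact Complex.I_ne_zero
  have hsq : (Real.sqrt p : ℂ) ^ 2 = p := by
    rw [← Complex.ofReal_pow, Real.sq_sqrt (Nat.cast_nonneg p), Complex.ofReal_natCast]
  have hpow : (Real.sqrt p : ℂ) ^ ((2 * n + 1) * k) = (p ^ n * Real.sqrt p) ^ k := by
    rw [pow_mul, pow_succ, pow_mul, hsq]
  have hp0 : (p : ℂ) ≠ 0 := Nat.cast_ne_zero.2 hp.ne_zero
  have hs0 : (Real.sqrt p : ℂ) ≠ 0 := fun h => hp0 (by rw [← hsq, h]; ring)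
  have hvu : (ψ ^ v) (v : ZMod (p ^ (2 * n + 1))) ≠ 0 := by
    have h : IsUnit (v : ZMod (p ^ (2 * n + 1))) :=
      (ZMod.isUnit_iff_coprime _ _).2
        (((Nat.Prime.coprime_iff_not_dvd hp).2 hvp).symm.pow_right _)
    exact (h.map (ψ ^ v)).ne_zero
  rw [hprod, hG v hvp, Finset.prod_congr rfl fun i _ => by rw [hχ i, hG (c i) (hci i)], hQ,
    Finset.prod_congr rfl fun i _ => by rw [hQ]] at hJ
  rw [Finset.prod_congr rfl fun i _ => by rw [hχ i], hprod, hLc, Nat.add_sub_cancel, hpow]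
  simp only [Finset.prod_mul_distrib, Finset.prod_const, Finset.card_univ, Fintype.card_fin, Finset.prod_pow_eq_pow_sum, ← hv]
    at hJ
  generalize ∏ i, (ψ ^ c i) (c i : ZMod (p ^ (2 * n + 1))) = A at hJ ⊢
  generalize ∏ i, (quadraticChar (ZMod p) (c i) : ℂ) = B at hJ ⊢
  generalize (quadraticChar (ZMod p) v : ℂ) = V at hJ hLv ⊢
  generalize (jacobiSym (-2 * r) p : ℂ) = L at hJ hL ⊢
  generalize (ψ ^ v) (v : ZMod (p ^ (2 * n + 1))) = U at hJ hvu ⊢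
  generalize Jsum χ 1 = J at hJ ⊢
  have hL0 : L ≠ 0 := fun h => by rw [h] at hL; norm_num at hL
  have hV0 : V ≠ 0 := fun h => by rw [h] at hLv; norm_num at hLv
  have hD : W ^ v * U * (p ^ n * (L * V * (eps p * Real.sqrt p))) ≠ 0 :=
    mul_ne_zero (mul_ne_zero (pow_ne_zero _ hW) hvu)
      (mul_ne_zero (pow_ne_zero _ hp0) (mul_ne_zero (mul_ne_zero hL0 hV0) (mul_ne_zero heps hs0)))
  apply mul_right_cancel₀ hD
  rw [hJ]
  generalize (p : ℂ) ^ n = Q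
  rw [mul_pow Q]
  linear_combination -(Q ^ (k + 1) * Real.sqrt p ^ (k + 1) * A * W ^ v * L ^ (k + 1) * B *
    eps p ^ (k + 1)) * (U⁻¹ * U * hLv + inv_mul_cancel₀ hvu)
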